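/- Suppose x_1 = x_i ∧ x_j for all i ≠ j with i, j ∈ {1,…,n} (so x_1 is the smallest element of S and S \ {x_1} is an antichain), and suppose Ψ_{S,f_1}(x_1) = f_1(x_1) ≠ 0. If k is the number of indices i with Ψ_{S,f_i}(x_i) = 0, then rank (S)_{f_1,…,f_n} = n − k. (Here for i > 1, Ψ_{S,f_i}(x_i) = f_i(x_i) − f_i(x_1).) -/

import Mathlib

open Finset Matrix
open scoped Classical

/-- One plus a square-zero matrix has unit determinant. -/
lemma isUnit_det_one_add_of_sq_zero {n : ℕ} (N : Matrix (Fin n) (Fin n) ℂ) (h : N * N = 0) :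
    IsUnit (1 + N).det := by
  apply Matrix.isUnit_det_of_right_inverse (B := 1 - N)
  have : (1 + N) * (1 - N) = 1 - N * N := by noncomm_ring
  rw [this, h, sub_zero]

/-- Suppose `x 0 = x i ⊓ x j` for all `i ≠ j` (so `x 0` is the smallest element
of `S` and the rest of `S` is an antichain), and suppose
`Ψ_{S,f 0}(x 0) = f 0 (x 0) ≠ 0`. If `k` is the number of indices `i` with
`Ψ_{S,f i}(x i) = 0`, then `rank (S)_{f₁,…,fₙ} = n - k`. -/
theorem row_adjusted_meet_matrix_rank_antichain
    {P : Type*} [Lattice P] {n : ℕ} (hn : 0 < n)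
    (x : Fin n → P) (f : Fin n → P → ℂ) (μ : Fin n → Fin n → ℂ)
    (hxinj : Function.Injective x)
    (hxord : ∀ i j : Fin n, x i ≤ x j → i ≤ j)
    (hbot : ∀ i j : Fin n, i ≠ j → x i ⊓ x j = x ⟨0, hn⟩)
    (hμ0 : ∀ i j : Fin n, ¬ x i ≤ x j → μ i j = 0)
    (hμ : ∀ i j : Fin n, x i ≤ x j →
      (∑ v ∈ univ.filter (fun v => x i ≤ x v ∧ x v ≤ x j), μ i v) =
        if i = j then 1 else 0)
    (hΨ0 : (∑ v ∈ univ.filter (fun v => x v ≤ x ⟨0, hn⟩),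
      f ⟨0, hn⟩ (x v) * μ v ⟨0, hn⟩) ≠ 0)
    (k : ℕ)
    (hk : k = (univ.filter (fun i : Fin n =>
      (∑ v ∈ univ.filter (fun v => x v ≤ x i), f i (x v) * μ v i) = 0)).card) :
    (Matrix.of fun i j : Fin n => f i (x i ⊓ x j)).rank = n - k := by
  obtain ⟨z, hz⟩ : ∃ z : Fin n, z = ⟨0, hn⟩ := ⟨_, rfl⟩
  rw [← hz] at hbot hΨ0
  have hle : ∀ i j : Fin n, x i ≤ x j ↔ i = z ∨ i = j := by
    intro i j
    constructor
    · intro h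
      by_cases hij : i = j
      · exact Or.inr hij
      · left
        have := hbot i j hij
        rw [inf_eq_left.mpr h] at this
        exact hxinj this
    · rintro (h | h)
      · by_cases hij : i = j
        · rw [hij]
        · have := hbot i j hij
          subst h
          exact inf_eq_left.mp this
      · rw [h]
  have hμd : ∀ i, μ i i = 1 := by
    intro i
    have h := hμ i i le_rfl
    have e : univ.filter (fun v => x i ≤ x v ∧ x v ≤ x i) = {i} := by
      ext v
      simp only [mem_filter, mem_univ, true_and, mem_singleton, hle]
      grind
    rw [e] at h
    simpa using h
  have hμz : ∀ j, j ≠ z → μ z j = -1 := by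
    intro j hj
    have h := hμ z j ((hle _ _).2 (Or.inl rfl))
    have e : univ.filter (fun v => x z ≤ x v ∧ x v ≤ x j) = {z, j} := by
      ext v
      simp only [mem_filter, mem_univ, true_and, mem_singleton, mem_insert, hle]
      grind
    rw [e, sum_pair hj.symm, hμd, if_neg hj.symm] at h
    linear_combination h
  obtain ⟨Ψ, hΨ⟩ : ∃ Ψ : Fin n → ℂ, Ψ = fun i =>
    ∑ v ∈ univ.filter (fun v => x v ≤ x i), f i (x v) * μ v i := ⟨_, rfl⟩
  have hΨz : Ψ z = f z (x z) := by
    have e : univ.filter (fun v => x v ≤ x z) = {z} := by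
      ext v
      simp [hle]
    simp only [hΨ]
    rw [e]
    simp [hμd]
  have hΨi : ∀ i, i ≠ z → Ψ i = f i (x i) - f i (x z) := by
    intro i hi
    have e : univ.filter (fun v => x v ≤ x i) = {z, i} := by
      ext v
      simp [hle]
    simp only [hΨ]
    rw [e, sum_pair hi.symm, hμd, hμz i hi]
    ring
  have h0 : f z (x z) ≠ 0 := by
    rw [← hΨz, hΨ]
    exact hΨ0
  let N : Matrix (Fin n) (Fin n) ℂ :=
    Matrix.of fun i m => if m = z ∧ i ≠ z then f i (x z) / f z (x z) else 0
  let U : Matrix (Fin n) (Fin n) ℂ :=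
    Matrix.of fun m j => if m = z ∧ j ≠ z then 1 else 0
  have hN : N * N = 0 := by
    ext i j
    rw [Matrix.mul_apply]
    refine Finset.sum_eq_zero fun m _ => ?_
    simp only [N, Matrix.of_apply]
    by_cases hm : m = z <;> simp [hm]
  have hU : U * U = 0 := by
    ext i j
    rw [Matrix.mul_apply]
    refine Finset.sum_eq_zero fun m _ => ?_
    simp only [U, Matrix.of_apply]
    by_cases hm : m = z <;> simp [hm]
  have hfac : (Matrix.of fun i j : Fin n => f i (x i ⊓ x j)) =
      (1 + N) * Matrix.diagonal Ψ * (1 + U) := by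
    have hDU : Matrix.diagonal Ψ * (1 + U) =
        Matrix.of fun m j => Ψ m * ((if m = j then 1 else 0) +
          if m = z ∧ j ≠ z then 1 else 0) := by
      ext m j
      simp [Matrix.diagonal_mul, U, Matrix.one_apply]
    rw [Matrix.mul_assoc, hDU, Matrix.add_mul, Matrix.one_mul]
    ext i j
    rw [Matrix.add_apply, Matrix.mul_apply, Finset.sum_eq_single z]
    · simp only [N, Matrix.of_apply]
      by_cases hi : i = z
      · subst hi
        by_cases hj : j = i
        · simp [hj, hΨz]
        · simp [hj, Ne.symm hj, hΨz, hbot i j (Ne.symm hj)]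
      · have hzj : (if z = j then (1 : ℂ) else 0) + (if True ∧ j ≠ z then 1 else 0) = 1 := by
          by_cases hj : j = z
          · simp [hj]
          · simp [hj, Ne.symm hj]
        rw [hzj, hΨz, hΨi i hi]
        by_cases hij : i = j
        · subst hij
          simp [hi]
          field_simp
          ring
        · simp [hi, hij, hbot i j hij]
          field_simp
    · intro m _ hm
      simp [N, hm]
    · simp
  rw [hfac, Matrix.rank_mul_eq_left_of_isUnit_det _ _ (isUnit_det_one_add_of_sq_zero U hU),
    Matrix.rank_mul_eq_right_of_isUnit_det _ _ (isUnit_det_one_add_of_sq_zero N hN),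
    Matrix.rank_diagonal]
  have hk' : k = (univ.filter (fun i : Fin n => Ψ i = 0)).card := by
    rw [hk, hΨ]
  have hc := Finset.card_filter_add_card_filter_not (s := (univ : Finset (Fin n)))
    (fun i => Ψ i = 0)
  rw [← hk', Finset.card_univ, Fintype.card_fin] at hc
  rw [Fintype.card_subtype]
  simp only [ne_eq]
  omega
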